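/- arXiv:2206.10603 — 2 statements merged into one kernel-verified Lean document; each statement's English description precedes it below -/
import Mathlib

section
/- Let G be a finite group in which every non-trivial irreducible representation has dimension at least d. Let X and Y be independent probability distributions on G^t. Then for every g in G, the probability that X_1 Y_1 X_2 Y_2 ... X_t Y_t = g differs from 1/|G| by at most (|G|^{2t-1}/d^{t-1}) * sqrt(E_{h in G^t} X(h)^2) * sqrt(E_{h in G^t} Y(h)^2), where X(h) denotes the probability mass of h under X and the expectation is over uniform h in G^t. -/
open scoped Matrix.Norms.L2Operator MatrixOrder ComplexOrder in
/-- Every finite-dimensional complex matrix representation of a finite group is conjugate to a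
unitary one. -/
theorem exists_unit_conjTranspose_conj_eq {G m : Type*} [Group G] [Fintype G] [Fintype m]
    [DecidableEq m] (ρ : G →* Matrix m m ℂ) :
    ∃ B : (Matrix m m ℂ)ˣ, ∀ g,
      ((B : Matrix m m ℂ) * ρ g * (↑B⁻¹ : Matrix m m ℂ)).conjTranspose =
        (B : Matrix m m ℂ) * ρ g⁻¹ * (↑B⁻¹ : Matrix m m ℂ) := by
  classical
  set P : Matrix m m ℂ := ∑ h, (ρ h).conjTranspose * ρ h with hP
  have hpos : P.PosDef := by
    have h1 : P = (ρ 1).conjTranspose * ρ 1 +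
        ∑ h ∈ Finset.univ.erase (1 : G), (ρ h).conjTranspose * ρ h := by
      rw [hP, ← Finset.add_sum_erase _ _ (Finset.mem_univ (1 : G))]
    rw [h1]
    refine Matrix.PosDef.add_posSemidef (by simpa using Matrix.PosDef.one) ?_
    exact Matrix.posSemidef_sum _ fun h _ => Matrix.posSemidef_conjTranspose_mul_self _
  obtain ⟨b, hb, hPb⟩ := CStarAlgebra.isStrictlyPositive_iff_eq_star_mul_self.mp
    hpos.isStrictlyPositive
  obtain ⟨B, rfl⟩ := hb
  refine ⟨B, fun g => ?_⟩
  have hinv : (ρ g).conjTranspose * P = P * ρ g⁻¹ := by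
    rw [hP, Finset.mul_sum, Finset.sum_mul]
    refine Fintype.sum_equiv (Equiv.mulRight g) _ _ fun h => ?_
    simp only [Equiv.coe_mulRight, map_mul, Matrix.conjTranspose_mul, mul_assoc]
    rw [← map_mul, mul_inv_cancel, map_one, mul_one]
  rw [hPb] at hinv
  have hB : (↑B⁻¹ : Matrix m m ℂ).conjTranspose * star (B : Matrix m m ℂ) = 1 := by
    rw [Matrix.star_eq_conjTranspose, ← Matrix.conjTranspose_mul]
    simp
  calc ((B : Matrix m m ℂ) * ρ g * (↑B⁻¹ : Matrix m m ℂ)).conjTranspose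
      = (↑B⁻¹ : Matrix m m ℂ).conjTranspose *
          ((ρ g).conjTranspose * (star (B : Matrix m m ℂ) * B)) * (↑B⁻¹ : Matrix m m ℂ) := by
        simp [Matrix.conjTranspose_mul, mul_assoc, Matrix.star_eq_conjTranspose]
    _ = ((↑B⁻¹ : Matrix m m ℂ).conjTranspose * star (B : Matrix m m ℂ)) *
          (B * ρ g⁻¹ * (↑B⁻¹ : Matrix m m ℂ)) := by rw [hinv]; simp only [mul_assoc]
    _ = _ := by rw [hB, one_mul]

/-- Wedderburn decomposition of the complex group algebra into matrix blocks on which the group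
acts unitarily. -/
theorem exists_algEquiv_pi_matrix_unitary (G : Type*) [Group G] [Fintype G] :
    ∃ (m : ℕ) (n : Fin m → ℕ)
      (Φ : MonoidAlgebra ℂ G ≃ₐ[ℂ] Π i, Matrix (Fin (n i)) (Fin (n i)) ℂ),
      (∀ i, NeZero (n i)) ∧
        ∀ i g, (Φ (.single g 1) i).conjTranspose = Φ (.single g⁻¹ 1) i := by
  have : NeZero (Nat.card G : ℂ) := ⟨by simp⟩
  have : FiniteDimensional ℂ (MonoidAlgebra ℂ G) :=
    Module.Finite.of_basis (MonoidAlgebra.basis G ℂ)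
  obtain ⟨m, n, hn, ⟨e⟩⟩ :=
    IsSemisimpleRing.exists_algEquiv_pi_matrix_of_isAlgClosed ℂ (MonoidAlgebra ℂ G)
  choose B hB using fun i => exists_unit_conjTranspose_conj_eq
    (((Pi.evalMonoidHom (fun i => Matrix (Fin (n i)) (Fin (n i)) ℂ) i).comp
      (e : MonoidAlgebra ℂ G →* _)).comp (MonoidAlgebra.of ℂ G))
  refine ⟨m, n, e.trans (AlgEquiv.piCongrRight fun i =>
    MulSemiringAction.toAlgEquiv ℂ _ (ConjAct.toConjAct (B i))), hn, fun i g => ?_⟩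
  simpa [ConjAct.units_smul_def] using hB i g

theorem trace_mulLeft_pi_matrix {m : ℕ} (n : Fin m → ℕ)
    (A : Π i, Matrix (Fin (n i)) (Fin (n i)) ℂ) :
    LinearMap.trace ℂ _ (LinearMap.mulLeft ℂ A) = ∑ i, (n i : ℂ) * (A i).trace := by
  classical
  have hrepr : ∀ (k : ℕ) (M : Matrix (Fin k) (Fin k) ℂ) a b,
      (Matrix.stdBasis ℂ (Fin k) (Fin k)).repr M (a, b) = M a b := fun k M a b => rfl
  rw [LinearMap.trace_eq_matrix_trace ℂ (Pi.basis fun i => Matrix.stdBasis ℂ (Fin (n i)) (Fin (n i))),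
    Matrix.trace, Fintype.sum_sigma]
  refine Finset.sum_congr rfl fun i _ => ?_
  rw [Fintype.sum_prod_type, Matrix.trace, Finset.mul_sum]
  refine Finset.sum_congr rfl fun a _ => ?_
  have h : ∀ b, (LinearMap.toMatrix
      (Pi.basis fun i => Matrix.stdBasis ℂ (Fin (n i)) (Fin (n i)))
      (Pi.basis fun i => Matrix.stdBasis ℂ (Fin (n i)) (Fin (n i)))
      (LinearMap.mulLeft ℂ A)).diag ⟨i, a, b⟩ = A i a a := by
    intro b
    rw [Matrix.diag_apply, LinearMap.toMatrix_apply, Pi.basis_repr, hrepr, Pi.basis_apply,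
      Matrix.stdBasis_eq_single]
    simp [Matrix.mul_apply, Matrix.single_apply]
  rw [Finset.sum_congr rfl fun b _ => h b]
  simp

theorem trace_mulLeft_monoidAlgebra {G : Type*} [Group G] [Fintype G] (a : MonoidAlgebra ℂ G) :
    LinearMap.trace ℂ _ (LinearMap.mulLeft ℂ a) = (Fintype.card G : ℂ) * a.coeff 1 := by
  classical
  rw [LinearMap.trace_eq_matrix_trace ℂ (MonoidAlgebra.basis G ℂ), Matrix.trace]
  have h : ∀ g, (LinearMap.toMatrix (MonoidAlgebra.basis G ℂ) (MonoidAlgebra.basis G ℂ)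
      (LinearMap.mulLeft ℂ a)).diag g = a.coeff 1 := by
    intro g
    rw [Matrix.diag_apply, LinearMap.toMatrix_apply, MonoidAlgebra.basis_apply]
    change (a * MonoidAlgebra.single g 1).coeff g = _
    rw [MonoidAlgebra.coeff_mul_single_eq_coeff_mul (m₂ := 1) (H := by simp), mul_one]
  rw [Finset.sum_congr rfl fun g _ => h g]
  simp

/-- A complete system of unitary irreducible matrix representations of a finite group: their
matrix coefficients satisfy Schur orthogonality, the regular character decomposes, and their
commutants are scalar. -/
theorem exists_unitary_irreps (G : Type*) [Group G] [Fintype G] [DecidableEq G] :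
    ∃ (m : ℕ) (n : Fin m → ℕ) (ρ : ∀ i, G →* Matrix (Fin (n i)) (Fin (n i)) ℂ),
      (∀ i, NeZero (n i)) ∧
      (∀ p q : Σ i, Fin (n i) × Fin (n i),
        ∑ g, star (ρ p.1 g p.2.1 p.2.2) * ρ q.1 g q.2.1 q.2.2 =
          if p = q then (Fintype.card G : ℂ) / n p.1 else 0) ∧
      (∀ z, ∑ i, (n i : ℂ) * (ρ i z).trace = if z = 1 then (Fintype.card G : ℂ) else 0) ∧
      (∀ i (M : Matrix (Fin (n i)) (Fin (n i)) ℂ), (∀ g, M * ρ i g = ρ i g * M) →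
        ∃ c : ℂ, M = c • (1 : Matrix (Fin (n i)) (Fin (n i)) ℂ)) := by
  classical
  obtain ⟨m, n, Φ, hn, hΦ⟩ := exists_algEquiv_pi_matrix_unitary G
  set ρ : ∀ i, G →* Matrix (Fin (n i)) (Fin (n i)) ℂ := fun i =>
    ((Pi.evalMonoidHom (fun i => Matrix (Fin (n i)) (Fin (n i)) ℂ) i).comp
      (Φ : MonoidAlgebra ℂ G →* _)).comp (MonoidAlgebra.of ℂ G) with hρ
  have hρΦ : ∀ i g, ρ i g = Φ (.single g 1) i := fun i g => rfl
  have hcard : (Fintype.card G : ℂ) ≠ 0 := by simp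
  have htr : ∀ a, ∑ i, (n i : ℂ) * (Φ a i).trace = (Fintype.card G : ℂ) * a.coeff 1 := by
    intro a
    rw [← trace_mulLeft_monoidAlgebra, ← trace_mulLeft_pi_matrix,
      ← LinearMap.trace_conj' (LinearMap.mulLeft ℂ a) Φ.toLinearEquiv]
    congr 1
    refine LinearMap.ext fun x => ?_
    simp [LinearEquiv.conj_apply]
  have hexp : ∀ a i, Φ a i = ∑ g, a.coeff g • ρ i g := by
    intro a i
    have ha : a = ∑ g, a.coeff g • MonoidAlgebra.single g (1 : ℂ) := by
      ext h
      simp [MonoidAlgebra.coeff_sum]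
    conv_lhs => rw [ha]
    rw [map_sum, Finset.sum_apply]
    exact Finset.sum_congr rfl fun g _ => by rw [map_smul, Pi.smul_apply, hρΦ]
  refine ⟨m, n, ρ, hn, ?_, ?_, ?_⟩
  · rintro ⟨i, a, b⟩ ⟨j, c, e⟩
    have := hn i
    have hni : (n i : ℂ) ≠ 0 := by simp [NeZero.ne]
    set u := Φ.symm (Pi.single i (Matrix.single a b 1)) with hu
    have hΦu : Φ u = Pi.single i (Matrix.single a b 1) := by simp [hu]
    have hcoeff : ∀ g, u.coeff g = (n i : ℂ) / Fintype.card G * star (ρ i g a b) := by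
      intro g
      have h1 := htr (.single g⁻¹ 1 * u)
      rw [MonoidAlgebra.coeff_single_mul_eq_mul_coeff (m₂ := g) (H := by simp [inv_mul_eq_one, eq_comm]),
        one_mul, map_mul, hΦu, Finset.sum_eq_single i] at h1
      · rw [Pi.mul_apply, ← hΦ, Pi.single_eq_same, Matrix.trace_mul_single] at h1
        simp at h1
        rw [hρΦ]
        rw [div_mul_eq_mul_div, eq_div_iff hcard, mul_comm]
        exact h1.symm
      · intro k _ hk
        simp [Pi.single_eq_of_ne hk]
      · simp
    have h2 := congrFun (congrFun (hexp u j) c) e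
    rw [hΦu, Matrix.sum_apply] at h2
    simp only [Matrix.smul_apply, smul_eq_mul, hcoeff, mul_assoc] at h2
    rw [← Finset.mul_sum] at h2
    have h3 : ∑ g, star (ρ i g a b) * ρ j g c e =
      (Fintype.card G : ℂ) / n i *
        (Pi.single i (Matrix.single a b 1) : Π i, Matrix (Fin (n i)) (Fin (n i)) ℂ) j c e := by
      rw [h2]; field_simp
    rw [h3]
    by_cases hij : i = j
    · subst hij
      simp [Matrix.single_apply]
    · rw [if_neg (fun h => hij (congrArg Sigma.fst h)), Pi.single_eq_of_ne (Ne.symm hij)]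
      simp
  · intro z
    rw [show ∑ i, (n i : ℂ) * (ρ i z).trace = _ from htr (.single z 1)]
    simp [Finsupp.single_apply]
  · intro i M hM
    have hcomm : ∀ A, Commute A M := by
      intro A
      have : A = ∑ g, (Φ.symm (Pi.single i A)).coeff g • ρ i g := by
        rw [← hexp]; simp
      rw [this]
      exact Commute.sum_left _ _ _ fun g _ => Commute.smul_left (hM g).symm _
    obtain ⟨c, hc⟩ := Matrix.mem_range_scalar_of_commute_single fun a b _ => hcomm _
    exact ⟨c, by rw [← hc, Matrix.smul_one_eq_diagonal]; rfl⟩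

theorem Matrix.list_prod_ofFn_apply {R n : Type*} [CommSemiring R] [Fintype n] [DecidableEq n]
    {s : ℕ} (C : Fin s → Matrix n n R) (i j : n) :
    (List.ofFn C).prod i j =
      ∑ p : Fin (s + 1) → n,
        if p 0 = i ∧ p (Fin.last s) = j then ∏ k : Fin s, C k (p k.castSucc) (p k.succ) else 0 := by
  induction s generalizing i with
  | zero =>
    rw [← (Equiv.funUnique (Fin 1) n).symm.sum_comp]
    simp only [List.ofFn_zero, List.prod_nil, Matrix.one_apply, Equiv.funUnique_symm_apply]
    by_cases h : i = j
    · subst h; simp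
    · rw [if_neg h, Finset.sum_eq_zero]
      intro x _
      rw [if_neg]
      rintro ⟨h1, h2⟩
      exact h (h1.symm.trans h2)
  | succ s ih =>
    rw [List.ofFn_succ, List.prod_cons, Matrix.mul_apply,
      ← (Fin.consEquiv fun _ => n).sum_comp, Fintype.sum_prod_type]
    symm
    rw [Finset.sum_eq_single i]
    · symm
      simp only [ih, Finset.mul_sum]
      rw [Finset.sum_comm]
      refine Finset.sum_congr rfl fun p _ => ?_
      rw [Finset.sum_eq_single (p 0)]
      · simp [Fin.consEquiv, Fin.prod_univ_succ, ← Fin.succ_last]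
      · intro b _ hb
        simp [Ne.symm hb]
      · simp
    · intro b _ hb
      refine Finset.sum_eq_zero fun p _ => ?_
      simp [Fin.consEquiv, hb]
    · simp

theorem Matrix.trace_list_prod_ofFn_mul {R n : Type*} [CommSemiring R] [Fintype n]
    [DecidableEq n] {s : ℕ} (A B : Fin s → Matrix n n R) :
    (List.ofFn fun k => A k * B k).prod.trace =
      ∑ q : {p : Fin (s + 1) → n // p 0 = p (Fin.last s)} × (Fin s → n),
        (∏ k, A k (q.1.1 k.castSucc) (q.2 k)) * ∏ k, B k (q.2 k) (q.1.1 k.succ) := by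
  simp only [Matrix.trace, Matrix.diag_apply, Matrix.list_prod_ofFn_apply]
  rw [Finset.sum_comm, Fintype.sum_prod_type,
    ← Finset.sum_subtype (Finset.univ.filter fun p : Fin (s + 1) → n => p 0 = p (Fin.last s))
      (by simp) (fun p => ∑ q : Fin s → n,
        (∏ k, A k (p k.castSucc) (q k)) * ∏ k, B k (q k) (p k.succ)),
    Finset.sum_filter]
  refine Finset.sum_congr rfl fun p _ => ?_
  rw [Finset.sum_eq_single (p 0)]
  · simp only [true_and, eq_comm (a := p 0)]
    refine if_congr Iff.rfl ?_ rfl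
    simp only [Matrix.mul_apply, Fintype.prod_sum, Finset.prod_mul_distrib]
  · intro b _ hb
    rw [if_neg]
    exact fun h => hb h.1.symm
  · simp

theorem bessel_matrix_coefficients {G : Type*} [Group G] [Fintype G] {m : ℕ}
    {n : Fin m → ℕ} (ρ : ∀ i, G →* Matrix (Fin (n i)) (Fin (n i)) ℂ) (hn : ∀ i, NeZero (n i))
    (horth : ∀ p q : Σ i, Fin (n i) × Fin (n i),
      ∑ g, star (ρ p.1 g p.2.1 p.2.2) * ρ q.1 g q.2.1 q.2.2 =
        if p = q then (Fintype.card G : ℂ) / n p.1 else 0)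
    {t : ℕ} [NeZero t] (X : (Fin t → G) → ℂ) {L : Type*} (S : Finset L)
    (f : L → Σ i, (Fin t → Fin (n i)) × (Fin t → Fin (n i))) (hf : f.Injective) :
    ∑ l ∈ S, ((√((n (f l).1 : ℝ) / Fintype.card G)) ^ t *
        ‖∑ x, X x * ∏ k, ρ (f l).1 (x k) ((f l).2.1 k) ((f l).2.2 k)‖) ^ 2 ≤
      ∑ x, ‖X x‖ ^ 2 := by
  classical
  set c : Fin m → ℝ := fun i => √((n i : ℝ) / Fintype.card G) with hc
  set v : (Σ i, (Fin t → Fin (n i)) × (Fin t → Fin (n i))) → EuclideanSpace ℂ (Fin t → G) :=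
    fun p => WithLp.toLp 2 fun x =>
      ((c p.1 ^ t : ℝ) : ℂ) * star (∏ k, ρ p.1 (x k) (p.2.1 k) (p.2.2 k)) with hv
  have hstar : ∀ r : ℝ, star (r : ℂ) = r := Complex.conj_ofReal
  have horthv : Orthonormal ℂ v := by
    rw [orthonormal_iff_ite]
    rintro p q
    have h1 : inner ℂ (v p) (v q) = ((c p.1 ^ t : ℝ) : ℂ) * ((c q.1 ^ t : ℝ) : ℂ) *
        ∏ k, if (⟨q.1, q.2.1 k, q.2.2 k⟩ : Σ i, Fin (n i) × Fin (n i)) =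
          ⟨p.1, p.2.1 k, p.2.2 k⟩ then (Fintype.card G : ℂ) / n q.1 else 0 := by
      simp only [← horth, Fintype.prod_sum, Finset.mul_sum, PiLp.inner_apply, hv]
      refine Finset.sum_congr rfl fun x _ => ?_
      simp only [RCLike.inner_apply, map_mul, Finset.prod_mul_distrib, star_prod,
        map_prod, starRingEnd_apply, star_star, hstar]
      ring
    rw [h1]
    split_ifs with hpq
    · subst hpq
      have h0 : (0 : ℝ) < n p.1 := by
        have := hn p.1
        exact_mod_cast Nat.pos_of_neZero _
      have hcc : c p.1 * c p.1 = (n p.1 : ℝ) / Fintype.card G :=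
        Real.mul_self_sqrt (by positivity)
      have hG : (0 : ℝ) < Fintype.card G := by exact_mod_cast Fintype.card_pos
      have : (c p.1 ^ t) * (c p.1 ^ t) * ((Fintype.card G : ℝ) / n p.1) ^ t = 1 := by
        rw [← mul_pow, hcc, ← mul_pow]
        field_simp
        simp
      simp only [if_true, Finset.prod_const, Finset.card_univ, Fintype.card_fin]
      have := congrArg Complex.ofReal this
      push_cast at this ⊢
      exact this
    · obtain ⟨k, hk⟩ : ∃ k : Fin t, (⟨q.1, q.2.1 k, q.2.2 k⟩ : Σ i, Fin (n i) × Fin (n i)) ≠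
          ⟨p.1, p.2.1 k, p.2.2 k⟩ := by
        by_contra! h
        obtain ⟨i, a, b⟩ := p
        obtain ⟨j, a', b'⟩ := q
        obtain rfl : j = i := congrArg Sigma.fst (h 0)
        have h' : ∀ k, a' k = a k ∧ b' k = b k := fun k => by simpa using h k
        exact hpq (by rw [funext fun k => (h' k).1, funext fun k => (h' k).2])
      rw [Finset.prod_eq_zero (Finset.mem_univ k) (if_neg hk), mul_zero]
  have hB := (horthv.comp f hf).sum_inner_products_le (WithLp.toLp 2 X) (s := S)
  rw [EuclideanSpace.norm_sq_eq] at hB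
  refine le_trans (le_of_eq ?_) hB
  refine Finset.sum_congr rfl fun l _ => ?_
  have h2 : inner ℂ ((v ∘ f) l) (WithLp.toLp 2 X) = ((c (f l).1 ^ t : ℝ) : ℂ) *
      ∑ x, X x * ∏ k, ρ (f l).1 (x k) ((f l).2.1 k) ((f l).2.2 k) := by
    simp only [PiLp.inner_apply, hv, Finset.mul_sum, Function.comp]
    refine Finset.sum_congr rfl fun x _ => ?_
    simp only [RCLike.inner_apply, map_mul, starRingEnd_apply, star_star, hstar]
    ring
  rw [h2, norm_mul, Complex.norm_real, Real.norm_of_nonneg (by positivity)]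

/-- The deviation from uniform of an interleaved product is the contribution of the non-trivial
irreducible representations. -/
theorem sum_nontrivial_irreps_trace {G : Type*} [Group G] [Fintype G] [DecidableEq G] {m : ℕ}
    {n : Fin m → ℕ} (ρ : ∀ i, G →* Matrix (Fin (n i)) (Fin (n i)) ℂ)
    (hreg : ∀ z, ∑ i, (n i : ℂ) * (ρ i z).trace = if z = 1 then (Fintype.card G : ℂ) else 0)
    (hirr : ∀ i (M : Matrix (Fin (n i)) (Fin (n i)) ℂ), (∀ g, M * ρ i g = ρ i g * M) →
      ∃ c : ℂ, M = c • (1 : Matrix (Fin (n i)) (Fin (n i)) ℂ))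
    [DecidablePred fun i => ∃ g, ρ i g ≠ 1] (z : G) :
    ∑ i with ∃ g, ρ i g ≠ 1, (n i : ℂ) / Fintype.card G * (ρ i z).trace =
      (if z = 1 then 1 else 0) - 1 / (Fintype.card G : ℂ) := by
  have hcard : (Fintype.card G : ℂ) ≠ 0 := by simp
  have hsum : ∀ i, (∃ g, ρ i g ≠ 1) → ∑ g, ρ i g = 0 := by
    rintro i ⟨g, hg⟩
    have hl : ∀ g, ρ i g * ∑ h, ρ i h = ∑ h, ρ i h := fun g => by
      rw [Finset.mul_sum]
      exact Fintype.sum_equiv (Equiv.mulLeft g) _ _ fun h => by simp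
    have hr : ∀ g, (∑ h, ρ i h) * ρ i g = ∑ h, ρ i h := fun g => by
      rw [Finset.sum_mul]
      exact Fintype.sum_equiv (Equiv.mulRight g) _ _ fun h => by simp
    obtain ⟨c, hc⟩ := hirr i (∑ h, ρ i h) fun g => by rw [hl, hr]
    have h1 := hl g
    rw [hc, mul_smul_comm, mul_one, ← sub_eq_zero, ← smul_sub, smul_eq_zero] at h1
    rcases h1 with rfl | h1
    · rw [hc, zero_smul]
    · exact absurd (sub_eq_zero.mp h1) hg
  have htriv : ∀ i, ¬ (∃ g, ρ i g ≠ 1) → ∀ g, ρ i g = 1 := fun i hi g => by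
    by_contra h
    exact hi ⟨g, h⟩
  have hsplit := hreg z
  have htot : ∑ i, (n i : ℂ) * (∑ g, ρ i g).trace = Fintype.card G := by
    simp only [Matrix.trace_sum, Finset.mul_sum]
    rw [Finset.sum_comm]
    simp [hreg]
  rw [← Finset.sum_filter_add_sum_filter_not _ fun i => ∃ g, ρ i g ≠ 1] at hsplit htot
  have hzero : ∑ i with ∃ g, ρ i g ≠ 1, (n i : ℂ) * (∑ g, ρ i g).trace = 0 :=
    Finset.sum_eq_zero fun i hi => by rw [hsum i (Finset.mem_filter.mp hi).2]; simp
  rw [hzero, zero_add] at htot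
  have hone : ∑ i with ¬ ∃ g, ρ i g ≠ 1, (n i : ℂ) * (ρ i z).trace = 1 := by
    apply mul_left_cancel₀ hcard
    rw [mul_one, Finset.mul_sum]
    refine Eq.trans (Finset.sum_congr rfl fun i hi => ?_) htot
    have h := htriv i (Finset.mem_filter.mp hi).2
    simp only [h, Finset.sum_const, Finset.card_univ, Matrix.trace_smul]
    rw [nsmul_eq_mul]
    ring
  rw [hone] at hsplit
  simp only [div_mul_eq_mul_div, ← Finset.sum_div]
  rw [eq_sub_of_add_eq hsplit, sub_div]
  split_ifs <;> simp [hcard]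

theorem norm_sum_interleaved_sub_le {G : Type*} [Group G] [Fintype G] [DecidableEq G]
    (d s : ℕ) (hd : 0 < d)
    (hquasi : ∀ (n : ℕ) (ρ : G →* Matrix (Fin n) (Fin n) ℂ),
      (∀ M : Matrix (Fin n) (Fin n) ℂ, (∀ g : G, M * ρ g = ρ g * M) →
        ∃ c : ℂ, M = c • (1 : Matrix (Fin n) (Fin n) ℂ)) →
      (∃ g : G, ρ g ≠ 1) → d ≤ n)
    (X Y : (Fin (s + 1) → G) → ℂ) :
    ‖∑ x, ∑ y, X x * Y y * ((if (List.ofFn fun k => x k * y k).prod = 1 then 1 else 0) -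
        1 / (Fintype.card G : ℂ))‖ ≤
      ((Fintype.card G : ℝ) / d) ^ s * (√(∑ x, ‖X x‖ ^ 2) * √(∑ y, ‖Y y‖ ^ 2)) := by
  classical
  obtain ⟨m, n, ρ, hn, horth, hreg, hirr⟩ := exists_unitary_irreps G
  have hG : (0 : ℝ) < Fintype.card G := by exact_mod_cast Fintype.card_pos
  let Q : Fin m → Type := fun i =>
    {p : Fin (s + 1 + 1) → Fin (n i) // p 0 = p (Fin.last (s + 1))} × (Fin (s + 1) → Fin (n i))
  let fX : (Σ i, Q i) → Σ i, (Fin (s + 1) → Fin (n i)) × (Fin (s + 1) → Fin (n i)) :=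
    fun l => ⟨l.1, fun k => l.2.1.1 k.castSucc, l.2.2⟩
  let fY : (Σ i, Q i) → Σ i, (Fin (s + 1) → Fin (n i)) × (Fin (s + 1) → Fin (n i)) :=
    fun l => ⟨l.1, l.2.2, fun k => l.2.1.1 k.succ⟩
  have hfX : fX.Injective := by
    rintro ⟨i, ⟨p, hp⟩, b⟩ ⟨j, ⟨p', hp'⟩, b'⟩ h
    obtain rfl : i = j := congrArg Sigma.fst h
    simp only [fX, Sigma.mk.injEq, heq_eq_eq, true_and, Prod.mk.injEq] at h
    obtain ⟨h1, rfl⟩ := h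
    obtain rfl : p = p' := by
      funext k
      refine Fin.lastCases ?_ (fun k => congrFun h1 k) k
      rw [← hp, ← hp']
      exact congrFun h1 0
    rfl
  have hfY : fY.Injective := by
    rintro ⟨i, ⟨p, hp⟩, b⟩ ⟨j, ⟨p', hp'⟩, b'⟩ h
    obtain rfl : i = j := congrArg Sigma.fst h
    simp only [fY, Sigma.mk.injEq, heq_eq_eq, true_and, Prod.mk.injEq] at h
    obtain ⟨rfl, h1⟩ := h
    obtain rfl : p = p' := by
      funext k
      refine Fin.cases ?_ (fun k => congrFun h1 k) k
      rw [hp, hp', ← Fin.succ_last]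
      exact congrFun h1 (Fin.last s)
    rfl
  set c : Fin m → ℝ := fun i => √((n i : ℝ) / Fintype.card G) ^ (s + 1) with hc
  set FX : (Σ i, Q i) → ℂ := fun l =>
    ∑ x, X x * ∏ k, ρ (fX l).1 (x k) ((fX l).2.1 k) ((fX l).2.2 k) with hFX
  set FY : (Σ i, Q i) → ℂ := fun l =>
    ∑ y, Y y * ∏ k, ρ (fY l).1 (y k) ((fY l).2.1 k) ((fY l).2.2 k) with hFY
  set S : Finset (Σ i, Q i) := (Finset.univ.filter fun i => ∃ g, ρ i g ≠ 1).sigma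
    fun _ => Finset.univ with hS
  have hBX : ∑ l ∈ S, (c l.1 * ‖FX l‖) ^ 2 ≤ ∑ x, ‖X x‖ ^ 2 :=
    bessel_matrix_coefficients ρ hn horth X S fX hfX
  have hBY : ∑ l ∈ S, (c l.1 * ‖FY l‖) ^ 2 ≤ ∑ y, ‖Y y‖ ^ 2 :=
    bessel_matrix_coefficients ρ hn horth Y S fY hfY
  have hexp : ∑ x, ∑ y, X x * Y y * ((if (List.ofFn fun k => x k * y k).prod = 1 then 1 else 0) -
        1 / (Fintype.card G : ℂ)) =
      ∑ l ∈ S, ((n l.1 : ℂ) / Fintype.card G) * (FX l * FY l) := by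
    have hprod : ∀ i (x y : Fin (s + 1) → G), (ρ i (List.ofFn fun k => x k * y k).prod).trace =
        ∑ q : Q i, (∏ k, ρ i (x k) (q.1.1 k.castSucc) (q.2 k)) *
          ∏ k, ρ i (y k) (q.2 k) (q.1.1 k.succ) := by
      intro i x y
      rw [map_list_prod, List.map_ofFn,
        ← Matrix.trace_list_prod_ofFn_mul (fun k => ρ i (x k)) (fun k => ρ i (y k))]
      simp [Function.comp_def]
    simp only [← sum_nontrivial_irreps_trace ρ hreg hirr, hprod, hS, Finset.sum_sigma,
      Finset.mul_sum]
    rw [Finset.sum_congr rfl fun x _ => Finset.sum_comm, Finset.sum_comm]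
    refine Finset.sum_congr rfl fun i _ => ?_
    rw [Finset.sum_congr rfl fun x _ => Finset.sum_comm, Finset.sum_comm]
    refine Finset.sum_congr rfl fun q _ => ?_
    rw [hFX, hFY, Finset.sum_mul_sum, Finset.mul_sum]
    simp only [Finset.mul_sum]
    refine Finset.sum_congr rfl fun x _ => Finset.sum_congr rfl fun y _ => ?_
    ring
  rw [hexp]
  have hterm : ∀ l ∈ S, ‖((n l.1 : ℂ) / Fintype.card G) * (FX l * FY l)‖ ≤
      ((Fintype.card G : ℝ) / d) ^ s * ((c l.1 * ‖FX l‖) * (c l.1 * ‖FY l‖)) := by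
    intro l hl
    have hdn : d ≤ n l.1 :=
      hquasi _ (ρ l.1) (hirr l.1) (Finset.mem_filter.mp (Finset.mem_sigma.mp hl).1).2
    have hd0 : (0 : ℝ) < d := by exact_mod_cast hd
    have hdn' : (d : ℝ) ≤ n l.1 := by exact_mod_cast hdn
    have hn0 : (0 : ℝ) < n l.1 := hd0.trans_le hdn'
    have hcc : c l.1 * c l.1 = ((n l.1 : ℝ) / Fintype.card G) ^ (s + 1) := by
      rw [hc, ← mul_pow, Real.mul_self_sqrt (by positivity)]
    have hcoef : (n l.1 : ℝ) / Fintype.card G ≤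
        ((Fintype.card G : ℝ) / d) ^ s * (c l.1 * c l.1) := by
      rw [hcc, pow_succ, ← mul_assoc, ← mul_pow]
      refine le_mul_of_one_le_left (by positivity) (one_le_pow₀ ?_)
      rw [div_mul_div_comm, mul_comm, mul_div_mul_right _ _ hG.ne']
      exact (one_le_div hd0).mpr hdn'
    calc ‖((n l.1 : ℂ) / Fintype.card G) * (FX l * FY l)‖
        = (n l.1 : ℝ) / Fintype.card G * (‖FX l‖ * ‖FY l‖) := by simp
      _ ≤ ((Fintype.card G : ℝ) / d) ^ s * (c l.1 * c l.1) * (‖FX l‖ * ‖FY l‖) := by gcongr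
      _ = _ := by ring
  calc _ ≤ ∑ l ∈ S, ((Fintype.card G : ℝ) / d) ^ s * ((c l.1 * ‖FX l‖) * (c l.1 * ‖FY l‖)) :=
        norm_sum_le_of_le _ hterm
    _ = ((Fintype.card G : ℝ) / d) ^ s * ∑ l ∈ S, (c l.1 * ‖FX l‖) * (c l.1 * ‖FY l‖) := by
        rw [Finset.mul_sum]
    _ ≤ _ := by
        gcongr
        refine (Real.sum_mul_le_sqrt_mul_sqrt _ _ _).trans ?_
        gcongr

/-- Interleaved mixing in quasirandom groups (main theorem):
if every non-trivial irreducible representation of `G` has dimension at least `d`,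
and `X`, `Y` are (independent) distributions on `G^t`, then the interleaved product
`X₁Y₁X₂Y₂⋯XₜYₜ` is close to uniform. -/
theorem interleaved_mixing {G : Type*} [Group G] [Fintype G] [DecidableEq G]
    (d t : ℕ) (ht : 0 < t) (hd : 0 < d)
    (hquasi : ∀ (n : ℕ) (ρ : G →* Matrix (Fin n) (Fin n) ℂ),
      (∀ M : Matrix (Fin n) (Fin n) ℂ, (∀ g : G, M * ρ g = ρ g * M) →
        ∃ c : ℂ, M = c • (1 : Matrix (Fin n) (Fin n) ℂ)) →
      (∃ g : G, ρ g ≠ 1) → d ≤ n)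
    (X Y : (Fin t → G) → ℝ)
    (hX0 : ∀ x, 0 ≤ X x) (hX1 : ∑ x : Fin t → G, X x = 1)
    (hY0 : ∀ y, 0 ≤ Y y) (hY1 : ∑ y : Fin t → G, Y y = 1)
    (g : G) :
    |(∑ x : Fin t → G, ∑ y : Fin t → G,
        if (List.ofFn fun k => x k * y k).prod = g then X x * Y y else 0)
      - 1 / (Fintype.card G : ℝ)| ≤
    ((Fintype.card G : ℝ) ^ (2 * t - 1) / (d : ℝ) ^ (t - 1)) *
      Real.sqrt (((Fintype.card G : ℝ) ^ t)⁻¹ * ∑ h : Fin t → G, X h ^ 2) *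
      Real.sqrt (((Fintype.card G : ℝ) ^ t)⁻¹ * ∑ h : Fin t → G, Y h ^ 2) := by
  obtain ⟨s, rfl⟩ : ∃ s, t = s + 1 := ⟨t - 1, by omega⟩
  have hG : (0 : ℝ) < Fintype.card G := by exact_mod_cast Fintype.card_pos
  set e : (Fin (s + 1) → G) ≃ (Fin (s + 1) → G) := Equiv.mulLeft (Pi.mulSingle 0 g) with he
  have hprod : ∀ x y : Fin (s + 1) → G, (List.ofFn fun k => e x k * y k).prod =
      g * (List.ofFn fun k => x k * y k).prod := by
    intro x y
    simp [he, List.ofFn_succ, mul_assoc]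
  have hkey := norm_sum_interleaved_sub_le d s hd hquasi
    (fun x => ((X (e x) : ℝ) : ℂ)) (fun y => (Y y : ℂ))
  have hL : ∑ x, ∑ y, (X (e x) : ℂ) * (Y y : ℂ) *
      ((if (List.ofFn fun k => x k * y k).prod = 1 then 1 else 0) - 1 / (Fintype.card G : ℂ)) =
      (((∑ x : Fin (s + 1) → G, ∑ y : Fin (s + 1) → G,
        if (List.ofFn fun k => x k * y k).prod = g then X x * Y y else 0)
      - 1 / (Fintype.card G : ℝ) : ℝ) : ℂ) := by
    have hmass : ∑ x, ∑ y, X (e x) * Y y * (1 / (Fintype.card G : ℝ)) =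
        1 / (Fintype.card G : ℝ) := by
      simp only [← Finset.sum_mul]
      rw [e.sum_comp (fun x => ∑ y, X x * Y y), ← Finset.sum_mul_sum, hX1, hY1, one_mul, one_mul]
    rw [← hmass, ← e.sum_comp (fun x : Fin (s + 1) → G => ∑ y : Fin (s + 1) → G,
      if (List.ofFn fun k => x k * y k).prod = g then X x * Y y else 0)]
    simp only [hprod, mul_eq_left, ← Finset.sum_sub_distrib]
    push_cast
    refine Finset.sum_congr rfl fun x _ => Finset.sum_congr rfl fun y _ => ?_
    split_ifs <;> push_cast <;> ring
  rw [hL, Complex.norm_real, Real.norm_eq_abs] at hkey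
  simp only [Complex.norm_real, Real.norm_eq_abs, sq_abs] at hkey
  rw [e.sum_comp (fun x => X x ^ 2)] at hkey
  refine hkey.trans (le_of_eq ?_)
  rw [Real.sqrt_mul (by positivity), Real.sqrt_mul (by positivity)]
  have hsq : √(((Fintype.card G : ℝ) ^ (s + 1))⁻¹) * √(((Fintype.card G : ℝ) ^ (s + 1))⁻¹) =
      ((Fintype.card G : ℝ) ^ (s + 1))⁻¹ := Real.mul_self_sqrt (by positivity)
  have hpow : (Fintype.card G : ℝ) ^ (2 * (s + 1) - 1) =
      (Fintype.card G : ℝ) ^ s * (Fintype.card G : ℝ) ^ (s + 1) := by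
    rw [← pow_add]; congr 1; omega
  calc _ = (Fintype.card G : ℝ) ^ (2 * (s + 1) - 1) / (d : ℝ) ^ s *
        (√(((Fintype.card G : ℝ) ^ (s + 1))⁻¹) * √(((Fintype.card G : ℝ) ^ (s + 1))⁻¹)) *
          (√(∑ x, X x ^ 2) * √(∑ y, Y y ^ 2)) := by
        rw [hsq, hpow, div_pow]; field_simp
    _ = _ := by rw [Nat.add_sub_cancel]; ring
end

section
/- Let G be a finite group with all non-trivial irreducible representations of dimension at least d > 1, and let t ≥ 2. If X and Y are independent and each uniform on subsets of G^t of density at least |G|^{1/2}/d^{(t-1)} · ε^{-1} (more precisely, if (αβ)^{1/2} ≥ d^{-(t-1)}/ε), then the interleaved product X_1 Y_1 ... X_t Y_t is within ε/|G| of uniform in L∞, i.e., every g ∈ G has probability in [(1-ε)/|G|, (1+ε)/|G|]. -/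
open Matrix

theorem trace_mulLeft_pi {r : ℕ} (n : Fin r → ℕ) (M : Π i, Matrix (Fin (n i)) (Fin (n i)) ℂ) :
    LinearMap.trace ℂ (Π i, Matrix (Fin (n i)) (Fin (n i)) ℂ) (LinearMap.mulLeft ℂ M) =
      ∑ i, (n i : ℂ) * (M i).trace := by
  classical
  rw [LinearMap.trace_eq_matrix_trace ℂ
    (Pi.basis fun i => Matrix.stdBasis ℂ (Fin (n i)) (Fin (n i))), Matrix.trace]
  simp only [diag_apply, LinearMap.toMatrix_apply, LinearMap.mulLeft_apply, Pi.basis_repr,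
    Pi.basis_apply, Pi.mul_apply, Pi.single_eq_same]
  rw [Fintype.sum_sigma]
  refine Finset.sum_congr rfl fun i _ => ?_
  rw [Fintype.sum_prod_type]
  have h (a b : Fin (n i)) : (Matrix.stdBasis ℂ (Fin (n i)) (Fin (n i))).repr
      (M i * Matrix.stdBasis ℂ (Fin (n i)) (Fin (n i)) (a, b)) (a, b) = M i a a := by
    rw [Matrix.stdBasis_eq_single]
    simp [Matrix.stdBasis]
  simp [h, Matrix.trace, Finset.mul_sum]

theorem trace_mulLeft_single {G : Type*} [Group G] [Fintype G] [DecidableEq G] (g : G) :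
    LinearMap.trace ℂ (MonoidAlgebra ℂ G) (LinearMap.mulLeft ℂ (MonoidAlgebra.of ℂ G g)) =
      if g = 1 then (Fintype.card G : ℂ) else 0 := by
  rw [LinearMap.trace_eq_matrix_trace ℂ (MonoidAlgebra.basis G ℂ), Matrix.trace]
  simp only [diag_apply, LinearMap.toMatrix_apply, LinearMap.mulLeft_apply]
  have (h : G) : ((MonoidAlgebra.basis G ℂ).repr
      (MonoidAlgebra.of ℂ G g * MonoidAlgebra.basis G ℂ h)) h = if g = 1 then 1 else 0 := by
    simp [MonoidAlgebra.basis, MonoidAlgebra.single_mul_single, MonoidAlgebra.coeff_single,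
      Finsupp.single_apply]
  simp_rw [this]
  split_ifs <;> simp

open scoped ComplexOrder MatrixOrder in
theorem exists_unitary_conj {G : Type*} [Group G] [Fintype G] {n : ℕ}
    (ρ : G →* Matrix (Fin n) (Fin n) ℂ) :
    ∃ B C : Matrix (Fin n) (Fin n) ℂ, B * C = 1 ∧ C * B = 1 ∧
      ∀ g, (B * ρ g * C)ᴴ = B * ρ g⁻¹ * C := by
  classical
  set P : Matrix (Fin n) (Fin n) ℂ := ∑ g : G, (ρ g)ᴴ * ρ g with hP
  have hinv (h : G) : (ρ h)ᴴ * P * ρ h = P := by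
    rw [hP, Finset.mul_sum, Finset.sum_mul]
    refine Fintype.sum_equiv (Equiv.mulRight h) _ _ fun g => ?_
    simp [Matrix.mul_assoc]
  have hpos : P.PosDef := by
    have h1 : P = 1 + ∑ g ∈ Finset.univ.erase (1 : G), (ρ g)ᴴ * ρ g := by
      rw [hP, ← Finset.add_sum_erase _ _ (Finset.mem_univ (1 : G))]
      simp
    rw [h1]
    exact Matrix.PosDef.one.add_posSemidef
      (Matrix.posSemidef_sum _ fun g _ => posSemidef_conjTranspose_mul_self _)
  obtain ⟨B, hB⟩ := CStarAlgebra.nonneg_iff_eq_star_mul_self.mp hpos.posSemidef.nonneg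
  rw [star_eq_conjTranspose] at hB
  have hBu : IsUnit B := by
    have := hpos.isUnit
    rw [hB, Matrix.isUnit_iff_isUnit_det, det_mul] at this
    exact (Matrix.isUnit_iff_isUnit_det _).2 (isUnit_of_mul_isUnit_right this)
  obtain ⟨C, hBC, hCB⟩ := isUnit_iff_exists.1 hBu
  refine ⟨B, C, hBC, hCB, fun g => ?_⟩
  have hCB' : Cᴴ * Bᴴ = 1 := by rw [← conjTranspose_mul, hBC, conjTranspose_one]
  have hρ : ρ g * ρ g⁻¹ = 1 := by rw [← map_mul, mul_inv_cancel, map_one]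
  calc (B * ρ g * C)ᴴ = Cᴴ * ((ρ g)ᴴ * (Bᴴ * B) * (ρ g * ρ g⁻¹)) * C := by
        rw [hρ, Matrix.mul_one, conjTranspose_mul, conjTranspose_mul]
        simp only [Matrix.mul_assoc, hBC, Matrix.mul_one]
    _ = Cᴴ * ((ρ g)ᴴ * P * ρ g) * ρ g⁻¹ * C := by rw [hB]; simp only [Matrix.mul_assoc]
    _ = (Cᴴ * Bᴴ) * B * ρ g⁻¹ * C := by rw [hinv, hB]; simp only [Matrix.mul_assoc]
    _ = _ := by rw [hCB', Matrix.one_mul]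

theorem exists_unitary_family (G : Type*) [Group G] [Fintype G] [DecidableEq G] :
    ∃ (r : ℕ) (n : Fin r → ℕ) (ρ : ∀ i, G →* Matrix (Fin (n i)) (Fin (n i)) ℂ),
      (∀ i g, (ρ i g)ᴴ = ρ i g⁻¹) ∧
      (∀ i, ∀ M : Matrix (Fin (n i)) (Fin (n i)) ℂ, (∀ g, M * ρ i g = ρ i g * M) →
        ∃ c : ℂ, M = c • (1 : Matrix (Fin (n i)) (Fin (n i)) ℂ)) ∧
      ∀ g, ∑ i, (n i : ℂ) * (ρ i g).trace = if g = 1 then (Fintype.card G : ℂ) else 0 := by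
  obtain ⟨r, n, -, ⟨e⟩⟩ :=
    IsSemisimpleRing.exists_algEquiv_pi_matrix_of_isAlgClosed ℂ (MonoidAlgebra ℂ G)
  let π (i : Fin r) : MonoidAlgebra ℂ G →ₐ[ℂ] Matrix (Fin (n i)) (Fin (n i)) ℂ :=
    (Pi.evalAlgHom ℂ (fun i => Matrix (Fin (n i)) (Fin (n i)) ℂ) i).comp e.toAlgHom
  let σ (i : Fin r) : G →* Matrix (Fin (n i)) (Fin (n i)) ℂ :=
    (π i : MonoidAlgebra ℂ G →* _).comp (MonoidAlgebra.of ℂ G)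
  choose B C hBC hCB hu using fun i => exists_unitary_conj (σ i)
  let ρ (i : Fin r) : G →* Matrix (Fin (n i)) (Fin (n i)) ℂ :=
    { toFun := fun g => B i * σ i g * C i
      map_one' := by rw [map_one, Matrix.mul_one, hBC]
      map_mul' := fun g h => by
        calc B i * σ i (g * h) * C i = B i * σ i g * 1 * σ i h * C i := by
              rw [map_mul, Matrix.mul_one, ← Matrix.mul_assoc (B i)]
          _ = _ := by rw [← hCB i]; simp only [Matrix.mul_assoc] }
  refine ⟨r, n, ρ, hu, fun i M hM => ?_, fun g => ?_⟩
  · have h1 (g : G) : (C i * M * B i) * σ i g = σ i g * (C i * M * B i) := by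
      have h2 : M * (B i * σ i g * C i) = B i * σ i g * C i * M := hM g
      calc (C i * M * B i) * σ i g = C i * (M * (B i * σ i g * C i)) * B i := by
            simp only [Matrix.mul_assoc, hCB, Matrix.mul_one]
        _ = (C i * B i) * σ i g * (C i * M * B i) := by rw [h2]; simp only [Matrix.mul_assoc]
        _ = _ := by rw [hCB, Matrix.one_mul]
    have h3 (a : MonoidAlgebra ℂ G) : Commute (π i a) (C i * M * B i) := by
      induction a using MonoidAlgebra.induction_on with
      | of g => exact (h1 g).symm
      | add x y hx hy => rw [map_add]; exact hx.add_left hy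
      | smul c x hx => rw [map_smul]; exact hx.smul_left c
    obtain ⟨c, hc⟩ := Matrix.mem_range_scalar_of_commute_single (M := C i * M * B i)
      fun a b _ => by
        have := h3 (e.symm (Pi.single i (Matrix.single a b 1)))
        simpa [π] using this
    refine ⟨c, ?_⟩
    calc M = (B i * C i) * M * (B i * C i) := by simp [hBC]
      _ = B i * (C i * M * B i) * C i := by simp only [Matrix.mul_assoc]
      _ = c • 1 := by
        rw [← hc, Matrix.scalar_apply, ← Matrix.smul_one_eq_diagonal]; simp [hBC]
  · have h4 (i : Fin r) : (ρ i g).trace = (σ i g).trace := by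
      change (B i * σ i g * C i).trace = _
      rw [Matrix.trace_mul_comm, ← Matrix.mul_assoc, hCB, Matrix.one_mul]
    simp_rw [h4]
    rw [← trace_mulLeft_single g, ← LinearMap.trace_conj' _ e.toLinearEquiv]
    rw [← trace_mulLeft_pi n fun i => σ i g]
    congr 1
    refine LinearMap.ext fun x => ?_
    simp [LinearEquiv.conj_apply, σ, π]

theorem sum_nontrivial_trace {G : Type*} [Group G] [Fintype G] [DecidableEq G]
    {ι : Type*} [Fintype ι] (n : ι → ℕ) (ρ : ∀ i, G →* Matrix (Fin (n i)) (Fin (n i)) ℂ)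
    (hirr : ∀ i, ∀ M : Matrix (Fin (n i)) (Fin (n i)) ℂ, (∀ g, M * ρ i g = ρ i g * M) →
      ∃ c : ℂ, M = c • (1 : Matrix (Fin (n i)) (Fin (n i)) ℂ))
    (hreg : ∀ g, ∑ i, (n i : ℂ) * (ρ i g).trace = if g = 1 then (Fintype.card G : ℂ) else 0)
    (S : Finset ι) (hS : ∀ i, i ∈ S ↔ ∃ g, ρ i g ≠ 1) (g : G) :
    ∑ i ∈ S, (n i : ℂ) * (ρ i g).trace = (if g = 1 then (Fintype.card G : ℂ) else 0) - 1 := by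
  classical
  have hzero (i : ι) (hi : i ∈ S) : ∑ h, ρ i h = 0 := by
    obtain ⟨k, hk⟩ := (hS i).1 hi
    have hl (h : G) : ρ i h * ∑ h, ρ i h = ∑ h, ρ i h := by
      rw [Finset.mul_sum]
      exact Fintype.sum_equiv (Equiv.mulLeft h) _ _ fun _ => by simp
    have hr (h : G) : (∑ h, ρ i h) * ρ i h = ∑ h, ρ i h := by
      rw [Finset.sum_mul]
      exact Fintype.sum_equiv (Equiv.mulRight h) _ _ fun _ => by simp
    obtain ⟨c, hc⟩ := hirr i _ fun h => (hr h).trans (hl h).symm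
    have := hl k
    rw [hc] at this ⊢
    by_cases h0 : c = 0
    · simp [h0]
    · exact absurd (by simpa [h0] using this) hk
  have htriv (i : ι) (hi : i ∈ Sᶜ) (h : G) : (ρ i h).trace = n i := by
    have : ρ i h = 1 := by
      by_contra hne
      exact Finset.mem_compl.1 hi ((hS i).2 ⟨h, hne⟩)
    simp [this]
  have hone : ∑ i ∈ Sᶜ, (n i : ℂ) * n i = 1 := by
    have hcard : (Fintype.card G : ℂ) ≠ 0 := by simp
    have h1 : ∑ h, ∑ i, (n i : ℂ) * (ρ i h).trace = Fintype.card G := by simp [hreg]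
    rw [Finset.sum_comm, ← Finset.sum_add_sum_compl S, Finset.sum_eq_zero, zero_add] at h1
    · rw [Finset.sum_congr rfl fun i hi => Finset.sum_congr rfl fun h _ => by
        rw [htriv i hi h]] at h1
      simp only [Finset.sum_const, Finset.card_univ, nsmul_eq_mul, ← Finset.mul_sum] at h1
      exact mul_left_cancel₀ hcard (by rw [h1, mul_one])
    · intro i hi
      rw [← Finset.mul_sum, ← Matrix.trace_sum, hzero i hi, Matrix.trace_zero, mul_zero]
  rw [← hreg g, ← Finset.sum_add_sum_compl S,
    Finset.sum_congr (s₁ := Sᶜ) rfl fun i hi => by rw [htriv i hi g], hone, add_sub_cancel_right]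

theorem prod_ofFn_apply {R ι : Type*} [CommSemiring R] [Fintype ι] [DecidableEq ι] {s : ℕ}
    (A : Fin (s + 1) → Matrix ι ι R) (a b : ι) :
    (List.ofFn A).prod a b = ∑ I : Fin s → ι,
      ∏ k, A k ((Fin.cons a I : Fin (s + 1) → ι) k) ((Fin.snoc I b : Fin (s + 1) → ι) k) := by
  induction s generalizing a with
  | zero => simp [Fin.snoc]
  | succ s ih =>
    rw [List.ofFn_succ, List.prod_cons, Matrix.mul_apply,
      ← (Fin.consEquiv fun _ : Fin (s + 1) => ι).sum_comp, Fintype.sum_prod_type]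
    refine Finset.sum_congr rfl fun c _ => ?_
    rw [ih, Finset.mul_sum]
    refine Finset.sum_congr rfl fun I _ => ?_
    rw [Fin.prod_univ_succ (n := s + 1)]
    have h : (Fin.snoc (Fin.cons c I : Fin (s + 1) → ι) b : Fin (s + 2) → ι) =
        Fin.cons c (Fin.snoc I b : Fin (s + 1) → ι) := (Fin.cons_snoc_eq_snoc_cons c I b).symm
    simp only [Fin.consEquiv, Equiv.coe_fn_mk, h, Fin.cons_zero, Fin.cons_succ]

theorem trace_prod_ofFn {R ι : Type*} [CommSemiring R] [Fintype ι] [DecidableEq ι] {s : ℕ}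
    (A : Fin (s + 1) → Matrix ι ι R) :
    (List.ofFn A).prod.trace = ∑ I : Fin (s + 1) → ι, ∏ k, A k (I k) (I (finRotate _ k)) := by
  rw [← (Fin.consEquiv fun _ : Fin (s + 1) => ι).sum_comp, Fintype.sum_prod_type, Matrix.trace]
  refine Finset.sum_congr rfl fun a _ => ?_
  rw [diag_apply, prod_ofFn_apply]
  simp [Fin.snoc_eq_cons_rotate, Fin.consEquiv]

theorem trace_map_prod_ofFn_mul {G R ι : Type*} [Monoid G] [CommSemiring R] [Fintype ι]
    [DecidableEq ι] {s : ℕ} (ρ : G →* Matrix ι ι R) (x y : Fin (s + 1) → G) :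
    (ρ (List.ofFn fun k => x k * y k).prod).trace =
      ∑ I : Fin (s + 1) → ι, ∑ J : Fin (s + 1) → ι,
        (∏ k, ρ (x k) (I k) (J k)) * ∏ k, ρ (y k) (J k) (I (finRotate _ k)) := by
  rw [map_list_prod, List.map_ofFn, trace_prod_ofFn]
  refine Finset.sum_congr rfl fun I _ => ?_
  simp only [Function.comp_apply, map_mul, Matrix.mul_apply, ← Finset.prod_mul_distrib]
  exact Fintype.prod_sum _

theorem sum_normSq_tensor {G κ : Type*} [Fintype G] [DecidableEq G] [Fintype κ] {t : ℕ}
    (φ : κ → G → ℂ) (c : ℝ)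
    (hφ : ∀ g h, ∑ k, φ k g * starRingEnd ℂ (φ k h) = if g = h then (c : ℂ) else 0)
    (F : (Fin t → G) → ℂ) :
    ∑ K : Fin t → κ, ‖∑ x, F x * ∏ j, φ (K j) (x j)‖ ^ 2 = c ^ t * ∑ x, ‖F x‖ ^ 2 := by
  have key (x y : Fin t → G) : ∑ K : Fin t → κ, (∏ j, φ (K j) (x j)) *
      starRingEnd ℂ (∏ j, φ (K j) (y j)) = if x = y then (c : ℂ) ^ t else 0 := by
    simp only [map_prod, ← Finset.prod_mul_distrib]
    rw [← Fintype.prod_sum fun j k => φ k (x j) * starRingEnd ℂ (φ k (y j))]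
    simp only [hφ]
    split_ifs with h
    · simp [h]
    · obtain ⟨j, hj⟩ := Function.ne_iff.1 h
      exact Finset.prod_eq_zero (Finset.mem_univ j) (if_neg hj)
  apply Complex.ofReal_injective
  push_cast
  simp only [← Complex.mul_conj', map_sum, Finset.sum_mul_sum, map_mul]
  calc _ = ∑ x, ∑ y, F x * starRingEnd ℂ (F y) * ∑ K : Fin t → κ, (∏ j, φ (K j) (x j)) *
        starRingEnd ℂ (∏ j, φ (K j) (y j)) := by
        rw [Finset.sum_comm]
        refine Finset.sum_congr rfl fun x _ => ?_
        rw [Finset.sum_comm]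
        refine Finset.sum_congr rfl fun y _ => ?_
        rw [Finset.mul_sum]
        exact Finset.sum_congr rfl fun K _ => by ring
    _ = _ := by
        simp only [key, mul_ite, mul_zero, Finset.sum_ite_eq, Finset.mem_univ, if_true,
          Finset.mul_sum]
        exact Finset.sum_congr rfl fun x _ => by ring

/-- The Fourier coefficient of `F` at the matrix coefficient of `ρ ⊗ ⋯ ⊗ ρ` indexed by `p`. -/
noncomputable def tensorCoeff {G ι : Type*} [Monoid G] [Fintype G] [Fintype ι] [DecidableEq ι]
    {t : ℕ} (ρ : G →* Matrix ι ι ℂ) (F : (Fin t → G) → ℂ) (p : (Fin t → ι) × (Fin t → ι)) : ℂ :=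
  ∑ x, F x * ∏ k, ρ (x k) (p.1 k) (p.2 k)

theorem sum_comp_le_of_injective {ι κ : Type*} [Fintype ι] [Fintype κ] {e : ι → κ}
    (he : Function.Injective e) (f : κ → ℝ) (hf : ∀ k, 0 ≤ f k) : ∑ i, f (e i) ≤ ∑ k, f k := by
  classical
  rw [← Finset.sum_image (f := f) he.injOn]
  exact Finset.sum_le_univ_sum_of_nonneg hf

theorem sum_tensorCoeff_le {G : Type*} [Group G] [Fintype G] [DecidableEq G]
    {ι : Type*} [Fintype ι] (n : ι → ℕ) (ρ : ∀ i, G →* Matrix (Fin (n i)) (Fin (n i)) ℂ)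
    (hunit : ∀ i g, (ρ i g)ᴴ = ρ i g⁻¹)
    (hreg : ∀ g, ∑ i, (n i : ℂ) * (ρ i g).trace = if g = 1 then (Fintype.card G : ℂ) else 0)
    {s : ℕ} (F : (Fin (s + 1) → G) → ℂ) :
    ∑ i, (n i : ℝ) ^ (s + 1) * ∑ p, ‖tensorCoeff (ρ i) F p‖ ^ 2 ≤
      (Fintype.card G : ℝ) ^ (s + 1) * ∑ x, ‖F x‖ ^ 2 := by
  classical
  let φ (k : Σ i, Fin (n i) × Fin (n i)) (g : G) : ℂ :=
    (√(n k.1 : ℝ) : ℂ) * ρ k.1 g k.2.1 k.2.2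
  have hφ (g h : G) : ∑ k, φ k g * starRingEnd ℂ (φ k h) =
      if g = h then ((Fintype.card G : ℝ) : ℂ) else 0 := by
    have h1 (i : ι) : ∑ q, φ ⟨i, q⟩ g * starRingEnd ℂ (φ ⟨i, q⟩ h) =
        (n i : ℂ) * (ρ i (g * h⁻¹)).trace := by
      have h2 : ((√(n i : ℝ) : ℝ) : ℂ) * ((√(n i : ℝ) : ℝ) : ℂ) = n i := by
        rw [← Complex.ofReal_mul, Real.mul_self_sqrt (Nat.cast_nonneg _), Complex.ofReal_natCast]
      rw [map_mul, ← hunit, Matrix.trace, Fintype.sum_prod_type, Finset.mul_sum]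
      refine Finset.sum_congr rfl fun a _ => ?_
      rw [diag_apply, Matrix.mul_apply, Finset.mul_sum]
      refine Finset.sum_congr rfl fun b _ => ?_
      simp only [φ, map_mul, Complex.conj_ofReal, conjTranspose_apply, ← h2]
      simp only [starRingEnd_apply]
      ring
    rw [Fintype.sum_sigma, Finset.sum_congr rfl fun i _ => h1 i, hreg]
    simp [mul_inv_eq_one]
  rw [← sum_normSq_tensor φ _ hφ F]
  let e (q : Σ i, (Fin (s + 1) → Fin (n i)) × (Fin (s + 1) → Fin (n i))) :
      Fin (s + 1) → Σ i, Fin (n i) × Fin (n i) := fun k => ⟨q.1, q.2.1 k, q.2.2 k⟩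
  have he : Function.Injective e := by
    rintro ⟨i, I, J⟩ ⟨i', I', J'⟩ h
    obtain rfl : i = i' := congrArg Sigma.fst (congrFun h 0)
    have h3 (k) : (I k, J k) = (I' k, J' k) := by simpa [e] using congrFun h k
    simp only [Prod.mk.injEq] at h3
    rw [funext fun k => (h3 k).1, funext fun k => (h3 k).2]
  let f (K : Fin (s + 1) → Σ i, Fin (n i) × Fin (n i)) : ℝ :=
    ‖∑ x, F x * ∏ j, φ (K j) (x j)‖ ^ 2
  calc _ = ∑ q, f (e q) := by
        rw [Fintype.sum_sigma]
        refine Finset.sum_congr rfl fun i _ => ?_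
        rw [Finset.mul_sum]
        refine Finset.sum_congr rfl fun p _ => ?_
        have h4 : ∑ x, F x * ∏ j, φ (e ⟨i, p⟩ j) (x j) =
            ((√(n i : ℝ) : ℝ) : ℂ) ^ (s + 1) * tensorCoeff (ρ i) F p := by
          simp only [φ, e, Finset.prod_mul_distrib, Finset.prod_const, Finset.card_univ,
            Fintype.card_fin, tensorCoeff, Finset.mul_sum]
          exact Finset.sum_congr rfl fun x _ => by ring
        simp only [f]
        rw [h4, norm_mul, mul_pow, norm_pow, Complex.norm_real, Real.norm_eq_abs, pow_right_comm,
          sq_abs, Real.sq_sqrt (Nat.cast_nonneg _)]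
    _ ≤ _ := sum_comp_le_of_injective he f fun _ => sq_nonneg _

theorem norm_sum_trace_le {G ι : Type*} [Monoid G] [Fintype G] [Fintype ι] [DecidableEq ι]
    {s : ℕ} (ρ : G →* Matrix ι ι ℂ) (F H : (Fin (s + 1) → G) → ℂ) :
    ‖∑ x, ∑ y, F x * H y * (ρ (List.ofFn fun k => x k * y k).prod).trace‖ ≤
      √(∑ p, ‖tensorCoeff ρ F p‖ ^ 2) * √(∑ p, ‖tensorCoeff ρ H p‖ ^ 2) := by
  let e : (Fin (s + 1) → ι) × (Fin (s + 1) → ι) ≃ (Fin (s + 1) → ι) × (Fin (s + 1) → ι) :=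
    (Equiv.prodComm _ _).trans
      (Equiv.prodCongr (Equiv.refl _) ((finRotate (s + 1)).symm.arrowCongr (Equiv.refl ι)))
  have h1 : ∑ x, ∑ y, F x * H y * (ρ (List.ofFn fun k => x k * y k).prod).trace =
      ∑ p, tensorCoeff ρ F p * tensorCoeff ρ H (e p) := by
    simp only [tensorCoeff, Finset.sum_mul_sum]
    symm
    rw [Finset.sum_comm]
    refine Finset.sum_congr rfl fun x _ => ?_
    rw [Finset.sum_comm]
    refine Finset.sum_congr rfl fun y _ => ?_
    rw [trace_map_prod_ofFn_mul, Fintype.sum_prod_type, Finset.mul_sum]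
    refine Finset.sum_congr rfl fun I _ => ?_
    rw [Finset.mul_sum]
    refine Finset.sum_congr rfl fun J _ => ?_
    simp only [e, Equiv.trans_apply, Equiv.prodComm_apply, Prod.swap_prod_mk,
      Equiv.prodCongr_apply, Prod.map_apply, Equiv.coe_refl, id_eq,
      Equiv.arrowCongr_apply, Equiv.symm_symm, Function.comp_apply]
    ring
  rw [h1, ← e.sum_comp fun p => ‖tensorCoeff ρ H p‖ ^ 2]
  refine (norm_sum_le _ _).trans ?_
  simp only [norm_mul]
  exact Real.sum_mul_le_sqrt_mul_sqrt _ _ _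

theorem norm_bilin_le {G : Type*} [Group G] [Fintype G] [DecidableEq G]
    {ι : Type*} [Fintype ι] (n : ι → ℕ) (ρ : ∀ i, G →* Matrix (Fin (n i)) (Fin (n i)) ℂ)
    (hunit : ∀ i g, (ρ i g)ᴴ = ρ i g⁻¹)
    (hreg : ∀ g, ∑ i, (n i : ℂ) * (ρ i g).trace = if g = 1 then (Fintype.card G : ℂ) else 0)
    {d : ℕ} (hd : 0 < d) (S : Finset ι) (hS : ∀ i ∈ S, d ≤ n i)
    {s : ℕ} (F H : (Fin (s + 1) → G) → ℂ) :
    ‖∑ x, ∑ y, F x * H y *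
        ∑ i ∈ S, (n i : ℂ) * (ρ i (List.ofFn fun k => x k * y k).prod).trace‖ ≤
      ((d : ℝ) ^ s)⁻¹ * ((Fintype.card G : ℝ) ^ (s + 1) *
        (√(∑ x, ‖F x‖ ^ 2) * √(∑ y, ‖H y‖ ^ 2))) := by
  have h1 : ∑ x, ∑ y, F x * H y *
        ∑ i ∈ S, (n i : ℂ) * (ρ i (List.ofFn fun k => x k * y k).prod).trace =
      ∑ i ∈ S, (n i : ℂ) *
        ∑ x, ∑ y, F x * H y * (ρ i (List.ofFn fun k => x k * y k).prod).trace := by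
    simp only [Finset.mul_sum, Finset.sum_comm (s := S)]
    exact Finset.sum_congr rfl fun x _ => Finset.sum_congr rfl fun y _ =>
      Finset.sum_congr rfl fun i _ => by ring
  set a : ι → ℝ := fun i => ∑ p, ‖tensorCoeff (ρ i) F p‖ ^ 2
  set b : ι → ℝ := fun i => ∑ p, ‖tensorCoeff (ρ i) H p‖ ^ 2
  have ha (i) : 0 ≤ a i := by positivity
  have hb (i) : 0 ≤ b i := by positivity
  have hd' : (0 : ℝ) < d := by exact_mod_cast hd
  calc _ ≤ ∑ i ∈ S, (n i : ℝ) * (√(a i) * √(b i)) := by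
        rw [h1]
        refine (norm_sum_le _ _).trans (Finset.sum_le_sum fun i _ => ?_)
        rw [norm_mul, Complex.norm_natCast]
        exact mul_le_mul_of_nonneg_left (norm_sum_trace_le _ _ _) (Nat.cast_nonneg _)
    _ ≤ ∑ i ∈ S, ((d : ℝ) ^ s)⁻¹ * (√(n i ^ (s + 1) * a i) * √(n i ^ (s + 1) * b i)) := by
        refine Finset.sum_le_sum fun i hi => ?_
        have hdn : (d : ℝ) ^ s ≤ n i ^ s := by
          gcongr
          exact_mod_cast hS i hi
        have hn : (n i : ℝ) ≤ ((d : ℝ) ^ s)⁻¹ * n i ^ (s + 1) := by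
          calc (n i : ℝ) = ((d : ℝ) ^ s)⁻¹ * (d ^ s * n i) := by
                rw [inv_mul_cancel_left₀ (by positivity)]
            _ ≤ _ := by rw [pow_succ (n i : ℝ)]; gcongr
        rw [Real.sqrt_mul (by positivity), Real.sqrt_mul (by positivity),
          mul_mul_mul_comm, Real.mul_self_sqrt (by positivity), ← mul_assoc _ (_ ^ (s + 1))]
        exact mul_le_mul_of_nonneg_right hn (by positivity)
    _ ≤ ((d : ℝ) ^ s)⁻¹ * (√(∑ i ∈ S, n i ^ (s + 1) * a i) * √(∑ i ∈ S, n i ^ (s + 1) * b i)) := by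
        rw [← Finset.mul_sum]
        gcongr
        exact Real.sum_sqrt_mul_sqrt_le _ (fun i => by positivity) fun i => by positivity
    _ ≤ ((d : ℝ) ^ s)⁻¹ * (√((Fintype.card G : ℝ) ^ (s + 1) * ∑ x, ‖F x‖ ^ 2) *
          √((Fintype.card G : ℝ) ^ (s + 1) * ∑ y, ‖H y‖ ^ 2)) := by
        gcongr
        · exact (Finset.sum_le_univ_sum_of_nonneg fun i => by positivity).trans
            (sum_tensorCoeff_le n ρ hunit hreg F)
        · exact (Finset.sum_le_univ_sum_of_nonneg fun i => by positivity).trans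
            (sum_tensorCoeff_le n ρ hunit hreg H)
    _ = _ := by
        rw [Real.sqrt_mul (by positivity), Real.sqrt_mul (by positivity), mul_mul_mul_comm,
          Real.mul_self_sqrt (by positivity)]

theorem prod_ofFn_cons_mul {G : Type*} [Group G] {s : ℕ} (g : G) (x y : Fin (s + 1) → G) :
    (List.ofFn fun k => ((Fin.cons g 1 : Fin (s + 1) → G) * x) k * y k).prod =
      g * (List.ofFn fun k => x k * y k).prod := by
  simp [List.ofFn_succ, mul_assoc]

theorem sum_uniform {α : Type*} [Fintype α] [DecidableEq α] {A : Finset α} (hA : A.Nonempty)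
    {X : α → ℝ} (hX : ∀ x, X x = if x ∈ A then (A.card : ℝ)⁻¹ else 0) : ∑ x, X x = 1 := by
  simp [hX, hA.card_pos.ne']

theorem sum_uniform_sq {α : Type*} [Fintype α] [DecidableEq α] {A : Finset α} (hA : A.Nonempty)
    {X : α → ℝ} (hX : ∀ x, X x = if x ∈ A then (A.card : ℝ)⁻¹ else 0) :
    ∑ x, X x ^ 2 = (A.card : ℝ)⁻¹ := by
  have : (A.card : ℝ) ≠ 0 := by exact_mod_cast hA.card_pos.ne'
  simp only [hX, ite_pow, Finset.sum_ite_mem, Finset.univ_inter, Finset.sum_const, nsmul_eq_mul,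
    ne_eq, OfNat.ofNat_ne_zero, not_false_eq_true, zero_pow]
  field_simp

theorem abs_card_mul_interleaved_sub_one_le {G : Type*} [Group G] [Fintype G] [DecidableEq G]
    {d s : ℕ} (hd : 0 < d)
    (hquasi : ∀ (n : ℕ) (ρ : G →* Matrix (Fin n) (Fin n) ℂ),
      (∀ M : Matrix (Fin n) (Fin n) ℂ, (∀ g : G, M * ρ g = ρ g * M) →
        ∃ c : ℂ, M = c • (1 : Matrix (Fin n) (Fin n) ℂ)) →
      (∃ g : G, ρ g ≠ 1) → d ≤ n)
    {X Y : (Fin (s + 1) → G) → ℝ} (hX : ∑ x, X x = 1) (hY : ∑ y, Y y = 1) (g : G) :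
    |(Fintype.card G : ℝ) * (∑ x, ∑ y,
        if (List.ofFn fun k => x k * y k).prod = g then X x * Y y else 0) - 1| ≤
      ((d : ℝ) ^ s)⁻¹ * ((Fintype.card G : ℝ) ^ (s + 1) *
        (√(∑ x, X x ^ 2) * √(∑ y, Y y ^ 2))) := by
  classical
  obtain ⟨r, n, ρ, hunit, hirr, hreg⟩ := exists_unitary_family G
  let S : Finset (Fin r) := {i | ∃ g, ρ i g ≠ 1}
  have hS (i) : i ∈ S ↔ ∃ g, ρ i g ≠ 1 := by simp [S]
  let e : (Fin (s + 1) → G) ≃ (Fin (s + 1) → G) := Equiv.mulLeft (Fin.cons g⁻¹ 1)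
  have key := norm_bilin_le n ρ hunit hreg hd S
    (fun i hi => hquasi _ (ρ i) (hirr i) ((hS i).1 hi))
    (fun x => (X (e.symm x) : ℂ)) (fun y => (Y y : ℂ))
  simp only [sum_nontrivial_trace n ρ hirr hreg S hS, Complex.norm_real, Real.norm_eq_abs,
    sq_abs] at key
  rw [e.symm.sum_comp fun x => X x ^ 2, ← e.sum_comp] at key
  convert key
  rw [← Real.norm_eq_abs, ← Complex.norm_real]
  congr 1
  have h1 (x y : Fin (s + 1) → G) :
      (List.ofFn fun k => e x k * y k).prod = 1 ↔ (List.ofFn fun k => x k * y k).prod = g := by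
    simp only [e, Equiv.coe_mulLeft, prod_ofFn_cons_mul]
    rw [inv_mul_eq_one, eq_comm]
  simp only [h1, Equiv.symm_apply_apply, mul_sub, mul_one, Finset.sum_sub_distrib,
    ← Finset.sum_mul_sum, mul_ite, mul_zero]
  push_cast
  rw [Finset.mul_sum, ← Complex.ofReal_sum, ← Complex.ofReal_sum, hX, hY]
  congr 1
  · refine Finset.sum_congr rfl fun x _ => ?_
    rw [Finset.mul_sum]
    refine Finset.sum_congr rfl fun y _ => ?_
    split_ifs <;> push_cast <;> ring
  · simp

/-- If `G` is quasirandom with parameter `d > 1`, `t ≥ 2`, and `A, B ⊆ G^t` are dense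
enough, namely `sqrt(αβ) ≥ d^{-(t-1)}/ε`, then the interleaved product of the uniform
distributions on `A` and `B` is within `ε/|G|` of uniform in `L∞`. -/
theorem interleaved_mixing_eps {G : Type*} [Group G] [Fintype G] [DecidableEq G]
    (d t : ℕ) (ht : 2 ≤ t) (hd : 1 < d)
    (hquasi : ∀ (n : ℕ) (ρ : G →* Matrix (Fin n) (Fin n) ℂ),
      (∀ M : Matrix (Fin n) (Fin n) ℂ, (∀ g : G, M * ρ g = ρ g * M) →
        ∃ c : ℂ, M = c • (1 : Matrix (Fin n) (Fin n) ℂ)) →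
      (∃ g : G, ρ g ≠ 1) → d ≤ n)
    (A B : Finset (Fin t → G)) (hA : A.Nonempty) (hB : B.Nonempty)
    (α β : ℝ)
    (hα : α = (A.card : ℝ) / (Fintype.card G : ℝ) ^ t)
    (hβ : β = (B.card : ℝ) / (Fintype.card G : ℝ) ^ t)
    (X Y : (Fin t → G) → ℝ)
    (hX : ∀ x, X x = if x ∈ A then ((A.card : ℝ))⁻¹ else 0)
    (hY : ∀ y, Y y = if y ∈ B then ((B.card : ℝ))⁻¹ else 0)
    (ε : ℝ) (hε : 0 < ε)
    (hdense : Real.sqrt (α * β) ≥ ((d : ℝ) ^ (t - 1))⁻¹ / ε)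
    (g : G) :
    (1 - ε) / (Fintype.card G : ℝ) ≤
      (∑ x : Fin t → G, ∑ y : Fin t → G,
        if (List.ofFn fun k => x k * y k).prod = g then X x * Y y else 0) ∧
    (∑ x : Fin t → G, ∑ y : Fin t → G,
        if (List.ofFn fun k => x k * y k).prod = g then X x * Y y else 0) ≤
      (1 + ε) / (Fintype.card G : ℝ) := by
  obtain ⟨s, rfl⟩ : ∃ s, t = s + 1 := ⟨t - 1, by omega⟩
  have key := abs_card_mul_interleaved_sub_one_le (Nat.zero_lt_of_lt hd) hquasi
    (sum_uniform hA hX) (sum_uniform hB hY) g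
  rw [sum_uniform_sq hA hX, sum_uniform_sq hB hY] at key
  rw [Nat.add_sub_cancel] at hdense
  have hN : (0 : ℝ) < Fintype.card G := by exact_mod_cast Fintype.card_pos
  have ha : (0 : ℝ) < A.card := by exact_mod_cast hA.card_pos
  have hb : (0 : ℝ) < B.card := by exact_mod_cast hB.card_pos
  have hsqrt : √(α * β) = √A.card * √B.card / (Fintype.card G : ℝ) ^ (s + 1) := by
    rw [hα, hβ, div_mul_div_comm, Real.sqrt_div (by positivity), Real.sqrt_mul_self (by positivity),
      Real.sqrt_mul ha.le]
  have hbound : ((d : ℝ) ^ s)⁻¹ * ((Fintype.card G : ℝ) ^ (s + 1) *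
      (√(A.card : ℝ)⁻¹ * √(B.card : ℝ)⁻¹)) ≤ ε := by
    rw [hsqrt, ge_iff_le, div_le_div_iff₀ hε (by positivity)] at hdense
    rw [Real.sqrt_inv, Real.sqrt_inv, ← mul_inv, ← mul_assoc, ← div_eq_mul_inv,
      div_le_iff₀ (by positivity)]
    linarith
  have h := abs_le.1 (key.trans hbound)
  rw [div_le_iff₀' hN, le_div_iff₀' hN]
  constructor <;> linarith [h.1, h.2]
end
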